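/- arXiv:2509.12921 — 3 statements merged into one kernel-verified Lean document; each statement's English description precedes it below -/
import Mathlib

section
/- Fix an integer d ≥ 1, β ∈ (0, min(d,2)), C > 0, ϱ ∈ (0,1), t₀ ≥ 0 and x₀ ∈ ℝ^d. For h ∈ (0,1) set ε = h^ϱ, I_h = [t₀, t₀+ε+h²], and for r ∈ I_h set I_{h,r} = [max(r−h², t₀), min(r, t₀+ε)]. Define Ã(z,r) = ∫_{I_{h,r}} ∫_{B(x₀,ε)} Γ_C(y−z, s+h²−r) dy ds and m²(h) = h^{−4} ∫_{I_h} ∫_{ℝ^d} ∫_{ℝ^d} Ã(z₁,r) Ã(z₂,r) ‖z₁−z₂‖^{−β} dz₁ dz₂ dr. Then there exist constants K ≥ 1 and h₀ ∈ (0,1), depending only on d, β, ϱ and C, such that for all h ∈ (0,h₀), K^{−1} h^{ϱ(2d−β+1)} ≤ m²(h) ≤ K h^{ϱ(2d−β+1)}. -/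
open MeasureTheory

/-- The Gaussian (heat-kernel type) kernel `Γ_C(x,t) = t^{−d/2} exp(−‖x‖²/(Ct))`. -/
noncomputable def GammaKer (d : ℕ) (C : ℝ) (x : EuclideanSpace ℝ (Fin d)) (t : ℝ) : ℝ :=
  t ^ (-(d : ℝ) / 2) * Real.exp (-‖x‖ ^ 2 / (C * t))

/-- `Ã(z,r) = ∫_{I_{h,r}} ∫_{B(x₀,ε)} Γ_C(y−z, s+h²−r) dy ds` where
`I_{h,r} = [max(r−h²,t₀), min(r, t₀+ε)]`. -/
noncomputable def Atilde (d : ℕ) (C t₀ : ℝ) (x₀ : EuclideanSpace ℝ (Fin d)) (ε h : ℝ)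
    (z : EuclideanSpace ℝ (Fin d)) (r : ℝ) : ℝ :=
  ∫ s in Set.Icc (max (r - h ^ 2) t₀) (min r (t₀ + ε)),
    ∫ y in Metric.ball x₀ ε, GammaKer d C (y - z) (s + h ^ 2 - r)

/-- `m²(h) = h^{−4} ∫_{I_h} ∫_{ℝ^d} ∫_{ℝ^d} Ã(z₁,r) Ã(z₂,r) ‖z₁−z₂‖^{−β} dz₁ dz₂ dr`
with `I_h = [t₀, t₀+ε+h²]`. -/
noncomputable def msq (d : ℕ) (C β t₀ : ℝ) (x₀ : EuclideanSpace ℝ (Fin d)) (ε h : ℝ) : ℝ :=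
  (∫ r in Set.Icc t₀ (t₀ + ε + h ^ 2),
      ∫ z₁ : EuclideanSpace ℝ (Fin d), ∫ z₂ : EuclideanSpace ℝ (Fin d),
        Atilde d C t₀ x₀ ε h z₁ r * Atilde d C t₀ x₀ ε h z₂ r * ‖z₁ - z₂‖ ^ (-β)) / h ^ 4

open Set Metric

section RieszEnergy

variable {d : ℕ} {β M m ε : ℝ} {f : EuclideanSpace ℝ (Fin d) → ℝ}

theorem setIntegral_ball_norm_rpow_neg (hε : 0 < ε) :
    ∫ x in ball (0 : EuclideanSpace ℝ (Fin d)) ε, ‖x‖ ^ (-β) =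
      ε ^ ((d : ℝ) - β) * ∫ x in ball (0 : EuclideanSpace ℝ (Fin d)) 1, ‖x‖ ^ (-β) := by
  have h := Measure.setIntegral_comp_smul_of_pos volume
    (fun x : EuclideanSpace ℝ (Fin d) ↦ ‖x‖ ^ (-β)) (ball 0 1) hε
  have hs : ∀ x : EuclideanSpace ℝ (Fin d), ‖ε • x‖ ^ (-β) = ε ^ (-β) * ‖x‖ ^ (-β) := fun x ↦ by
    rw [norm_smul, Real.norm_of_nonneg hε.le, Real.mul_rpow hε.le (norm_nonneg _)]
  simp only [hs, smul_unitBall_of_pos hε, integral_const_mul, finrank_euclideanSpace_fin,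
    smul_eq_mul] at h
  rw [sub_eq_add_neg, Real.rpow_add hε, Real.rpow_natCast, mul_assoc, h,
    mul_inv_cancel_left₀ (by positivity)]

theorem integrableOn_ball_norm_rpow_neg (hd : 1 ≤ d) (hβ : β < d) :
    IntegrableOn (fun x : EuclideanSpace ℝ (Fin d) ↦ ‖x‖ ^ (-β)) (ball 0 ε) := by
  refine integrableOn_ball_of_norm_le_rpow (C := 1) (α := β) (by simpa using hd)
    (by simpa using hβ) (ae_of_all _ fun x ↦ ?_)
    (Measurable.pow_const (by fun_prop) _).aestronglyMeasurable
  rw [one_mul, Real.norm_of_nonneg (by positivity)]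

theorem integrable_mul_norm_sub_rpow_neg (hd : 1 ≤ d) (hβ0 : 0 < β) (hβ : β < d) (hε : 0 < ε)
    (hf : Integrable f) (hf0 : ∀ z, 0 ≤ f z) (hfM : ∀ z, f z ≤ M)
    (z : EuclideanSpace ℝ (Fin d)) :
    Integrable (fun w ↦ f w * ‖z - w‖ ^ (-β)) ∧
      ∫ w, f w * ‖z - w‖ ^ (-β) ≤
        M * (ε ^ ((d : ℝ) - β) * ∫ x in ball (0 : EuclideanSpace ℝ (Fin d)) 1, ‖x‖ ^ (-β)) +
          ε ^ (-β) * ∫ w, f w := by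
  set φ : EuclideanSpace ℝ (Fin d) → ℝ := (ball 0 ε).indicator fun x ↦ ‖x‖ ^ (-β) with hφ
  have hφi : Integrable φ :=
    (integrable_indicator_iff measurableSet_ball).2 (integrableOn_ball_norm_rpow_neg hd hβ)
  have hint : Integrable fun w ↦ M * φ (z - w) + ε ^ (-β) * f w :=
    ((hφi.comp_sub_left z).const_mul M).add (hf.const_mul _)
  have hle : ∀ w, f w * ‖z - w‖ ^ (-β) ≤ M * φ (z - w) + ε ^ (-β) * f w := fun w ↦ by
    have hM : 0 ≤ M := (hf0 w).trans (hfM w)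
    have hpos : 0 ≤ ‖z - w‖ ^ (-β) := by positivity
    by_cases hw : z - w ∈ ball (0 : EuclideanSpace ℝ (Fin d)) ε
    · rw [hφ, indicator_of_mem hw]
      have := mul_le_mul_of_nonneg_right (hfM w) hpos
      have := mul_nonneg (Real.rpow_nonneg hε.le (-β)) (hf0 w)
      linarith
    · rw [hφ, indicator_of_notMem hw, mul_zero, zero_add, mul_comm]
      rw [mem_ball_zero_iff, not_lt] at hw
      exact mul_le_mul_of_nonneg_right
        (Real.rpow_le_rpow_of_nonpos hε hw (by linarith)) (hf0 w)
  have hi : Integrable (fun w ↦ f w * ‖z - w‖ ^ (-β)) := by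
    refine hint.mono' (hf.aestronglyMeasurable.mul
      (Measurable.pow_const (by fun_prop) _).aestronglyMeasurable) (ae_of_all _ fun w ↦ ?_)
    rw [Real.norm_of_nonneg (mul_nonneg (hf0 w) (by positivity))]
    exact hle w
  refine ⟨hi, (integral_mono hi hint hle).trans_eq ?_⟩
  rw [integral_add ((hφi.comp_sub_left z).const_mul M) (hf.const_mul _), integral_const_mul,
    integral_const_mul, integral_sub_left_eq_self φ volume z, hφ,
    integral_indicator measurableSet_ball, setIntegral_ball_norm_rpow_neg hε]

theorem integrable_energy_density (hd : 1 ≤ d) (hβ0 : 0 < β) (hβ : β < d) (hε : 0 < ε)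
    (hf : Integrable f) (hfm : Measurable f) (hf0 : ∀ z, 0 ≤ f z) (hfM : ∀ z, f z ≤ M) :
    Integrable fun z₁ ↦ ∫ z₂, f z₁ * f z₂ * ‖z₁ - z₂‖ ^ (-β) := by
  simp only [mul_assoc, integral_const_mul]
  refine hf.mul_bdd (c := M * (ε ^ ((d : ℝ) - β) *
    ∫ x in ball (0 : EuclideanSpace ℝ (Fin d)) 1, ‖x‖ ^ (-β)) + ε ^ (-β) * ∫ w, f w)
    ?_ (ae_of_all _ fun z ↦ ?_)
  · exact (StronglyMeasurable.integral_prod_right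
      (f := fun z w : EuclideanSpace ℝ (Fin d) ↦ f w * ‖z - w‖ ^ (-β))
      (by unfold Function.uncurry; fun_prop)).aestronglyMeasurable
  · rw [Real.norm_of_nonneg (integral_nonneg fun w ↦ mul_nonneg (hf0 w) (by positivity))]
    exact (integrable_mul_norm_sub_rpow_neg hd hβ0 hβ hε hf hf0 hfM z).2

/-- A function bounded by `M` has Riesz energy controlled by `M` and its integral,
at any cut-off scale `ε`. -/
theorem energy_le (hd : 1 ≤ d) (hβ0 : 0 < β) (hβ : β < d) (hε : 0 < ε)
    (hf : Integrable f) (hfm : Measurable f) (hf0 : ∀ z, 0 ≤ f z) (hfM : ∀ z, f z ≤ M) :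
    ∫ z₁, ∫ z₂, f z₁ * f z₂ * ‖z₁ - z₂‖ ^ (-β) ≤
      (∫ w, f w) * (M * (ε ^ ((d : ℝ) - β) *
        ∫ x in ball (0 : EuclideanSpace ℝ (Fin d)) 1, ‖x‖ ^ (-β)) + ε ^ (-β) * ∫ w, f w) := by
  rw [← integral_mul_const]
  refine integral_mono (integrable_energy_density hd hβ0 hβ hε hf hfm hf0 hfM)
    (hf.mul_const _) fun z ↦ ?_
  simp only [mul_assoc, integral_const_mul]
  exact mul_le_mul_of_nonneg_left
    (integrable_mul_norm_sub_rpow_neg hd hβ0 hβ hε hf hf0 hfM z).2 (hf0 z)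

/-- A nonnegative function that is at least `m` on a ball of radius `ε / 2` has large
Riesz energy. -/
theorem le_energy (hd : 1 ≤ d) (hβ0 : 0 < β) (hβ : β < d) (hε : 0 < ε)
    (hf : Integrable f) (hfm : Measurable f) (hf0 : ∀ z, 0 ≤ f z) (hfM : ∀ z, f z ≤ M)
    (hm : 0 ≤ m) {x₀ : EuclideanSpace ℝ (Fin d)} (hfb : ∀ z ∈ ball x₀ (ε / 2), m ≤ f z) :
    (m * volume.real (ball x₀ (ε / 2))) ^ 2 * ε ^ (-β) ≤
      ∫ z₁, ∫ z₂, f z₁ * f z₂ * ‖z₁ - z₂‖ ^ (-β) := by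
  have : Nonempty (Fin d) := ⟨⟨0, hd⟩⟩
  have hfin : volume (ball x₀ (ε / 2)) ≠ ⊤ := measure_ball_lt_top.ne
  have key : ∀ z ∈ ball x₀ (ε / 2),
      m * (m * ε ^ (-β) * volume.real (ball x₀ (ε / 2))) ≤
        ∫ w, f z * f w * ‖z - w‖ ^ (-β) := fun z hz ↦ by
    have hi := (integrable_mul_norm_sub_rpow_neg hd hβ0 hβ hε hf hf0 hfM z).1
    simp only [mul_assoc, integral_const_mul]
    refine mul_le_mul (hfb z hz) ?_ (by positivity) (hf0 z)
    calc m * (ε ^ (-β) * volume.real (ball x₀ (ε / 2)))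
        = ∫ _ in ball x₀ (ε / 2), m * ε ^ (-β) := by simp; ring
      _ ≤ ∫ w in ball x₀ (ε / 2), f w * ‖z - w‖ ^ (-β) := by
        refine setIntegral_mono_on_ae (integrableOn_const hfin) hi.integrableOn
          measurableSet_ball ?_
        filter_upwards [compl_mem_ae_iff.2 (measure_singleton z)] with w hw hwb
        have hzw : 0 < ‖z - w‖ := norm_pos_iff.2 (sub_ne_zero.2 fun h ↦ hw h.symm)
        have hlt : ‖z - w‖ ≤ ε := by
          rw [← dist_eq_norm]
          have := dist_triangle_right z w x₀
          rw [mem_ball] at hz hwb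
          linarith
        exact mul_le_mul (hfb w hwb) (Real.rpow_le_rpow_of_nonpos hzw hlt (by linarith))
          (by positivity) (hf0 w)
      _ ≤ ∫ w, f w * ‖z - w‖ ^ (-β) :=
        setIntegral_le_integral hi (ae_of_all _ fun w ↦ mul_nonneg (hf0 w) (by positivity))
  have hI := integrable_energy_density hd hβ0 hβ hε hf hfm hf0 hfM
  calc (m * volume.real (ball x₀ (ε / 2))) ^ 2 * ε ^ (-β)
      = ∫ _ in ball x₀ (ε / 2), m * (m * ε ^ (-β) * volume.real (ball x₀ (ε / 2))) := by
        simp; ring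
    _ ≤ ∫ z in ball x₀ (ε / 2), ∫ w, f z * f w * ‖z - w‖ ^ (-β) :=
      setIntegral_mono_on (integrableOn_const hfin) hI.integrableOn measurableSet_ball key
    _ ≤ _ := setIntegral_le_integral hI (ae_of_all _ fun z ↦ integral_nonneg fun w ↦
        mul_nonneg (mul_nonneg (hf0 z) (hf0 w)) (by positivity))

end RieszEnergy

section GaussianKernel

variable {d : ℕ} {C τ ε h t₀ r : ℝ} {x₀ z : EuclideanSpace ℝ (Fin d)}

theorem volume_real_ball_eq (hε : 0 < ε) :
    volume.real (ball x₀ ε) =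
      ε ^ d * volume.real (ball (0 : EuclideanSpace ℝ (Fin d)) 1) := by
  rw [Measure.real, Measure.addHaar_ball_of_pos volume x₀ hε, ENNReal.toReal_mul,
    ENNReal.toReal_ofReal (by positivity), finrank_euclideanSpace_fin, Measure.real]

theorem GammaKer_nonneg (hτ : 0 ≤ τ) (x : EuclideanSpace ℝ (Fin d)) :
    0 ≤ GammaKer d C x τ := by
  unfold GammaKer; positivity

theorem measurable_GammaKer :
    Measurable fun p : EuclideanSpace ℝ (Fin d) × ℝ ↦ GammaKer d C p.1 p.2 := by
  unfold GammaKer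
  exact (measurable_snd.pow_const _).mul (by fun_prop)

theorem integrable_GammaKer_and_integral_le (hd : 1 ≤ d) (hC : 0 < C) (hτ : 0 ≤ τ) :
    Integrable (fun x ↦ GammaKer d C x τ) ∧
      ∫ x, GammaKer d C x τ ≤ (Real.pi * C) ^ ((d : ℝ) / 2) := by
  unfold GammaKer
  rcases hτ.eq_or_lt with rfl | hτ
  · have h0 : (0 : ℝ) ^ (-(d : ℝ) / 2) = 0 :=
      Real.zero_rpow (by have : (1 : ℝ) ≤ d := mod_cast hd
                         exact ne_of_lt (by linarith))
    have := Real.pi_pos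
    simp only [h0, zero_mul, integral_zero]
    exact ⟨integrable_zero _ _ _, by positivity⟩
  · have hb : 0 < (C * τ)⁻¹ := by positivity
    have hexp : ∀ x : EuclideanSpace ℝ (Fin d),
        -‖x‖ ^ 2 / (C * τ) = -(C * τ)⁻¹ * ‖x‖ ^ 2 := fun x ↦ by ring
    have hI := GaussianFourier.integral_rexp_neg_mul_sq_norm
      (V := EuclideanSpace ℝ (Fin d)) hb
    simp only [hexp, integral_const_mul, hI, finrank_euclideanSpace_fin]
    have hpi := Real.pi_pos
    refine ⟨(Integrable.of_integral_ne_zero ?_).const_mul _, le_of_eq ?_⟩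
    · rw [hI]; positivity
    · rw [div_inv_eq_mul, ← mul_assoc, Real.mul_rpow (by positivity) hτ.le, mul_left_comm,
        ← Real.rpow_add hτ, neg_div, neg_add_cancel, Real.rpow_zero, mul_one]

theorem setIntegral_GammaKer_mem_Icc (hd : 1 ≤ d) (hC : 0 < C) (hτ : 0 ≤ τ) :
    ∫ y in ball x₀ ε, GammaKer d C (y - z) τ ∈ Icc 0 ((Real.pi * C) ^ ((d : ℝ) / 2)) := by
  obtain ⟨hi, hle⟩ := integrable_GammaKer_and_integral_le hd hC hτ
  refine ⟨integral_nonneg fun y ↦ GammaKer_nonneg hτ _, ?_⟩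
  refine (setIntegral_le_integral (hi.comp_sub_right z)
    (ae_of_all _ fun y ↦ GammaKer_nonneg hτ _)).trans ?_
  rwa [integral_sub_right_eq_self (fun x ↦ GammaKer d C x τ) z]

theorem le_setIntegral_GammaKer (hd : 1 ≤ d) (hC : 0 < C) (hτ : 0 < τ) (hτε : √τ ≤ ε / 2)
    (hz : z ∈ ball x₀ (ε / 2)) :
    volume.real (ball (0 : EuclideanSpace ℝ (Fin d)) 1) * Real.exp (-1 / C) ≤
      ∫ y in ball x₀ ε, GammaKer d C (y - z) τ := by
  have hi := (integrable_GammaKer_and_integral_le hd hC hτ.le).1.comp_sub_right z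
  have hsub : ball z √τ ⊆ ball x₀ ε := ball_subset_ball' (by rw [mem_ball] at hz; linarith)
  calc volume.real (ball (0 : EuclideanSpace ℝ (Fin d)) 1) * Real.exp (-1 / C)
      = ∫ _ in ball z √τ, τ ^ (-(d : ℝ) / 2) * Real.exp (-1 / C) := by
        rw [setIntegral_const, volume_real_ball_eq (Real.sqrt_pos.2 hτ), ← Real.rpow_natCast,
          Real.sqrt_eq_rpow, ← Real.rpow_mul hτ.le, smul_eq_mul]
        have : τ ^ (1 / 2 * (d : ℝ)) * τ ^ (-(d : ℝ) / 2) = 1 := by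
          rw [← Real.rpow_add hτ]; ring_nf; exact Real.rpow_zero τ
        linear_combination (-volume.real (ball (0 : EuclideanSpace ℝ (Fin d)) 1)
          * Real.exp (-1 / C)) * this
    _ ≤ ∫ y in ball z √τ, GammaKer d C (y - z) τ := by
        refine setIntegral_mono_on (integrableOn_const measure_ball_lt_top.ne) hi.integrableOn
          measurableSet_ball fun y hy ↦ ?_
        rw [mem_ball, dist_eq_norm] at hy
        have h2 : ‖y - z‖ ^ 2 ≤ τ := by
          rw [← Real.sq_sqrt hτ.le]; gcongr
        unfold GammaKer
        refine mul_le_mul_of_nonneg_left (Real.exp_le_exp.2 ?_) (by positivity)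
        rw [neg_div, neg_div, neg_le_neg_iff, div_le_div_iff₀ (by positivity) hC]
        nlinarith
    _ ≤ ∫ y in ball x₀ ε, GammaKer d C (y - z) τ :=
        setIntegral_mono_set hi.integrableOn (ae_of_all _ fun y ↦ GammaKer_nonneg hτ.le _)
          hsub.eventuallyLE

theorem measurable_Atilde : Measurable fun p : EuclideanSpace ℝ (Fin d) × ℝ ↦
    Atilde d C t₀ x₀ ε h p.1 p.2 := by
  have hin : Measurable fun q : (EuclideanSpace ℝ (Fin d) × ℝ) × ℝ ↦
      ∫ y in ball x₀ ε, GammaKer d C (y - q.1.1) (q.2 + h ^ 2 - q.1.2) := by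
    refine (StronglyMeasurable.integral_prod_right (f := fun
      (q : (EuclideanSpace ℝ (Fin d) × ℝ) × ℝ) y ↦
        GammaKer d C (y - q.1.1) (q.2 + h ^ 2 - q.1.2)) ?_).measurable
    exact (measurable_GammaKer.comp (g := fun p : EuclideanSpace ℝ (Fin d) × ℝ ↦
      GammaKer d C p.1 p.2) (f := fun p : ((EuclideanSpace ℝ (Fin d) × ℝ) × ℝ) ×
        EuclideanSpace ℝ (Fin d) ↦ (p.2 - p.1.1.1, p.1.2 + h ^ 2 - p.1.1.2))
      (by fun_prop)).stronglyMeasurable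
  have hs : MeasurableSet {q : (EuclideanSpace ℝ (Fin d) × ℝ) × ℝ |
      q.2 ∈ Icc (max (q.1.2 - h ^ 2) t₀) (min q.1.2 (t₀ + ε))} := by
    exact (measurableSet_le (f := fun q : (EuclideanSpace ℝ (Fin d) × ℝ) × ℝ ↦
        max (q.1.2 - h ^ 2) t₀) (by fun_prop) measurable_snd).inter
      (measurableSet_le measurable_snd (by fun_prop))
  unfold Atilde
  simp only [← integral_indicator measurableSet_Icc]
  exact (StronglyMeasurable.integral_prod_right' (f := fun
    q : (EuclideanSpace ℝ (Fin d) × ℝ) × ℝ ↦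
      {q : (EuclideanSpace ℝ (Fin d) × ℝ) × ℝ |
        q.2 ∈ Icc (max (q.1.2 - h ^ 2) t₀) (min q.1.2 (t₀ + ε))}.indicator
      (fun q ↦ ∫ y in ball x₀ ε, GammaKer d C (y - q.1.1) (q.2 + h ^ 2 - q.1.2)) q)
    (hin.indicator hs).stronglyMeasurable).measurable

theorem volume_real_Icc_max_min_le :
    volume.real (Icc (max (r - h ^ 2) t₀) (min r (t₀ + ε))) ≤ h ^ 2 := by
  rw [Measure.real, Real.volume_Icc]
  refine ENNReal.toReal_le_of_le_ofReal (sq_nonneg h) (ENNReal.ofReal_le_ofReal ?_)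
  linarith [le_max_left (r - h ^ 2) t₀, min_le_left r (t₀ + ε)]

theorem nonneg_of_mem_Icc_max_min {s : ℝ}
    (hs : s ∈ Icc (max (r - h ^ 2) t₀) (min r (t₀ + ε))) : 0 ≤ s + h ^ 2 - r := by
  linarith [(le_max_left (r - h ^ 2) t₀).trans hs.1]

theorem Atilde_nonneg (hd : 1 ≤ d) (hC : 0 < C) : 0 ≤ Atilde d C t₀ x₀ ε h z r :=
  setIntegral_nonneg measurableSet_Icc fun _ hs ↦
    (setIntegral_GammaKer_mem_Icc hd hC (nonneg_of_mem_Icc_max_min hs)).1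

theorem Atilde_le (hd : 1 ≤ d) (hC : 0 < C) :
    Atilde d C t₀ x₀ ε h z r ≤ (Real.pi * C) ^ ((d : ℝ) / 2) * h ^ 2 := by
  have hpi := Real.pi_pos
  refine (Real.le_norm_self _).trans ((norm_setIntegral_le_of_norm_le_const
    (C := (Real.pi * C) ^ ((d : ℝ) / 2)) measure_Icc_lt_top fun s hs ↦ ?_).trans ?_)
  · have := setIntegral_GammaKer_mem_Icc (x₀ := x₀) (z := z) (ε := ε) hd hC
      (nonneg_of_mem_Icc_max_min hs)
    rw [Real.norm_of_nonneg this.1]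
    exact this.2
  · exact mul_le_mul_of_nonneg_left volume_real_Icc_max_min_le (by positivity)

theorem le_Atilde (hd : 1 ≤ d) (hC : 0 < C) (hh : 0 < h) (hhε : h ≤ ε / 2)
    (hr : r ∈ Icc (t₀ + h ^ 2) (t₀ + ε)) (hz : z ∈ ball x₀ (ε / 2)) :
    volume.real (ball (0 : EuclideanSpace ℝ (Fin d)) 1) * Real.exp (-1 / C) * h ^ 2 ≤
      Atilde d C t₀ x₀ ε h z r := by
  have hIcc : Icc (max (r - h ^ 2) t₀) (min r (t₀ + ε)) = Icc (r - h ^ 2) r := by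
    rw [max_eq_left (by linarith [hr.1]), min_eq_left hr.2]
  have hmeas : Measurable fun s ↦ ∫ y in ball x₀ ε, GammaKer d C (y - z) (s + h ^ 2 - r) := by
    refine (StronglyMeasurable.integral_prod_right (f := fun s y ↦
        GammaKer d C (y - z) (s + h ^ 2 - r)) ?_).measurable
    exact (measurable_GammaKer.comp (g := fun p : EuclideanSpace ℝ (Fin d) × ℝ ↦
      GammaKer d C p.1 p.2) (f := fun p : ℝ × EuclideanSpace ℝ (Fin d) ↦
        (p.2 - z, p.1 + h ^ 2 - r)) (by fun_prop)).stronglyMeasurable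
  have hint : IntegrableOn (fun s ↦ ∫ y in ball x₀ ε, GammaKer d C (y - z) (s + h ^ 2 - r))
      (Ioc (r - h ^ 2) r) := by
    refine Measure.integrableOn_of_bounded (M := (Real.pi * C) ^ ((d : ℝ) / 2))
      measure_Ioc_lt_top.ne hmeas.aestronglyMeasurable
      ((ae_restrict_iff' measurableSet_Ioc).2 (ae_of_all _ fun s hs ↦ ?_))
    have := setIntegral_GammaKer_mem_Icc (x₀ := x₀) (z := z) (ε := ε) (τ := s + h ^ 2 - r) hd hC
      (by linarith [hs.1])
    rw [Real.norm_of_nonneg this.1]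
    exact this.2
  rw [Atilde, hIcc, integral_Icc_eq_integral_Ioc]
  calc volume.real (ball (0 : EuclideanSpace ℝ (Fin d)) 1) * Real.exp (-1 / C) * h ^ 2
      = ∫ _ in Ioc (r - h ^ 2) r,
          volume.real (ball (0 : EuclideanSpace ℝ (Fin d)) 1) * Real.exp (-1 / C) := by
        rw [setIntegral_const, Real.volume_real_Ioc_of_le (by nlinarith), smul_eq_mul]; ring
    _ ≤ _ := setIntegral_mono_on (integrableOn_const measure_Ioc_lt_top.ne) hint
        measurableSet_Ioc fun s hs ↦ le_setIntegral_GammaKer hd hC (by linarith [hs.1])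
          ((Real.sqrt_le_left hh.le |>.2 (by linarith [hs.2])).trans hhε) hz

theorem integrable_Atilde_and_integral_le (hd : 1 ≤ d) (hC : 0 < C) :
    Integrable (fun z ↦ Atilde d C t₀ x₀ ε h z r) ∧
      ∫ z, Atilde d C t₀ x₀ ε h z r ≤
        h ^ 2 * volume.real (ball x₀ ε) * (Real.pi * C) ^ ((d : ℝ) / 2) := by
  have hpi := Real.pi_pos
  set I := Icc (max (r - h ^ 2) t₀) (min r (t₀ + ε))
  have hmeas : Measurable fun z ↦ Atilde d C t₀ x₀ ε h z r :=
    measurable_Atilde.comp (g := fun p : EuclideanSpace ℝ (Fin d) × ℝ ↦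
      Atilde d C t₀ x₀ ε h p.1 p.2) (f := fun z ↦ (z, r)) (by fun_prop)
  have hker : ∀ s ∈ I, ∀ y : EuclideanSpace ℝ (Fin d),
      ∫⁻ z, ‖GammaKer d C (y - z) (s + h ^ 2 - r)‖ₑ ≤
        ENNReal.ofReal ((Real.pi * C) ^ ((d : ℝ) / 2)) := fun s hs y ↦ by
    have hτ := nonneg_of_mem_Icc_max_min hs
    obtain ⟨hi, hle⟩ := integrable_GammaKer_and_integral_le hd hC hτ
    rw [lintegral_sub_left_eq_self (fun x ↦ ‖GammaKer d C x (s + h ^ 2 - r)‖ₑ) y,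
      ← ofReal_integral_norm_eq_lintegral_enorm hi]
    simp only [Real.norm_of_nonneg (GammaKer_nonneg hτ _)]
    exact ENNReal.ofReal_le_ofReal hle
  have hle : ∫⁻ z, ‖Atilde d C t₀ x₀ ε h z r‖ₑ ≤
      ENNReal.ofReal (h ^ 2 * volume.real (ball x₀ ε) * (Real.pi * C) ^ ((d : ℝ) / 2)) :=
    calc ∫⁻ z, ‖Atilde d C t₀ x₀ ε h z r‖ₑ
        ≤ ∫⁻ z, ∫⁻ s in I, ∫⁻ y in ball x₀ ε, ‖GammaKer d C (y - z) (s + h ^ 2 - r)‖ₑ :=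
          lintegral_mono fun z ↦ (enorm_integral_le_lintegral_enorm _).trans
            (lintegral_mono fun s ↦ enorm_integral_le_lintegral_enorm _)
      _ = ∫⁻ s in I, ∫⁻ y in ball x₀ ε, ∫⁻ z, ‖GammaKer d C (y - z) (s + h ^ 2 - r)‖ₑ := by
          rw [lintegral_lintegral_swap]
          · refine lintegral_congr fun s ↦ ?_
            rw [lintegral_lintegral_swap]
            exact ((measurable_GammaKer (C := C)).comp (f := fun p : EuclideanSpace ℝ (Fin d) ×
              EuclideanSpace ℝ (Fin d) ↦ (p.2 - p.1, s + h ^ 2 - r))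
                (by fun_prop)).enorm.aemeasurable
          · refine (Measurable.lintegral_prod_right' (f := fun q :
              (EuclideanSpace ℝ (Fin d) × ℝ) × EuclideanSpace ℝ (Fin d) ↦
                ‖GammaKer d C (q.2 - q.1.1) (q.1.2 + h ^ 2 - r)‖ₑ) ?_).aemeasurable
            exact ((measurable_GammaKer (C := C)).comp (f := fun q :
              (EuclideanSpace ℝ (Fin d) × ℝ) × EuclideanSpace ℝ (Fin d) ↦
                (q.2 - q.1.1, q.1.2 + h ^ 2 - r)) (by fun_prop)).enorm
      _ ≤ ∫⁻ _ in I, ∫⁻ _ in ball x₀ ε, ENNReal.ofReal ((Real.pi * C) ^ ((d : ℝ) / 2)) :=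
          setLIntegral_mono' measurableSet_Icc fun s hs ↦ lintegral_mono fun y ↦ hker s hs y
      _ = ENNReal.ofReal (volume.real I * volume.real (ball x₀ ε) *
            (Real.pi * C) ^ ((d : ℝ) / 2)) := by
          rw [setLIntegral_const, setLIntegral_const, ENNReal.ofReal_mul (by positivity),
            ENNReal.ofReal_mul (by positivity), ofReal_measureReal measure_Icc_lt_top.ne,
            ofReal_measureReal measure_ball_lt_top.ne]
          ring
      _ ≤ _ := by
          gcongr
          exact volume_real_Icc_max_min_le
  have hi : Integrable (fun z ↦ Atilde d C t₀ x₀ ε h z r) :=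
    ⟨hmeas.aestronglyMeasurable, hle.trans_lt ENNReal.ofReal_lt_top⟩
  refine ⟨hi, ?_⟩
  rw [← ENNReal.ofReal_le_ofReal_iff (by positivity)]
  refine le_trans (le_of_eq ?_) hle
  rw [← ofReal_integral_norm_eq_lintegral_enorm hi]
  simp only [Real.norm_of_nonneg (Atilde_nonneg hd hC)]

end GaussianKernel

section Msq

variable {d : ℕ} {β C ε h t₀ : ℝ} {x₀ : EuclideanSpace ℝ (Fin d)}

theorem rpow_two_mul_sub_add_one (hε : 0 < ε) :
    ε ^ (2 * (d : ℝ) - β + 1) = (ε ^ d) ^ 2 * ε ^ (-β) * ε := by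
  rw [Real.rpow_add hε, sub_eq_add_neg, Real.rpow_add hε, Real.rpow_one, two_mul,
    Real.rpow_add hε, Real.rpow_natCast, sq]

theorem energy_Atilde_le (hd : 1 ≤ d) (hβ0 : 0 < β) (hβ : β < d) (hC : 0 < C) (hε : 0 < ε)
    (r : ℝ) :
    ∫ z₁ : EuclideanSpace ℝ (Fin d), ∫ z₂ : EuclideanSpace ℝ (Fin d),
        Atilde d C t₀ x₀ ε h z₁ r * Atilde d C t₀ x₀ ε h z₂ r * ‖z₁ - z₂‖ ^ (-β) ≤
      h ^ 4 * ((ε ^ d) ^ 2 * ε ^ (-β)) * (((Real.pi * C) ^ ((d : ℝ) / 2)) ^ 2 *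
        volume.real (ball (0 : EuclideanSpace ℝ (Fin d)) 1) *
        ((∫ x in ball (0 : EuclideanSpace ℝ (Fin d)) 1, ‖x‖ ^ (-β)) +
          volume.real (ball (0 : EuclideanSpace ℝ (Fin d)) 1))) := by
  have hpi := Real.pi_pos
  obtain ⟨hi, hle⟩ := integrable_Atilde_and_integral_le (x₀ := x₀) (ε := ε) (h := h) (t₀ := t₀)
    (r := r) hd hC
  rw [volume_real_ball_eq hε] at hle
  have hP : 0 ≤ ∫ x in ball (0 : EuclideanSpace ℝ (Fin d)) 1, ‖x‖ ^ (-β) :=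
    integral_nonneg fun x ↦ by positivity
  refine (energy_le hd hβ0 hβ hε hi
    (measurable_Atilde.comp (measurable_id.prodMk measurable_const))
    (fun _ ↦ Atilde_nonneg hd hC) fun _ ↦ Atilde_le hd hC).trans ?_
  have h0 : 0 ≤ ∫ z, Atilde d C t₀ x₀ ε h z r := integral_nonneg fun _ ↦ Atilde_nonneg hd hC
  rw [sub_eq_add_neg, Real.rpow_add hε, Real.rpow_natCast]
  refine (mul_le_mul hle (add_le_add_right (mul_le_mul_of_nonneg_left hle
    (Real.rpow_nonneg hε.le _)) _) (by positivity) (by positivity)).trans_eq ?_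
  ring

theorem energy_Atilde_nonneg (hd : 1 ≤ d) (hC : 0 < C) (r : ℝ) :
    0 ≤ ∫ z₁ : EuclideanSpace ℝ (Fin d), ∫ z₂ : EuclideanSpace ℝ (Fin d),
        Atilde d C t₀ x₀ ε h z₁ r * Atilde d C t₀ x₀ ε h z₂ r * ‖z₁ - z₂‖ ^ (-β) :=
  integral_nonneg fun _ ↦ integral_nonneg fun _ ↦
    mul_nonneg (mul_nonneg (Atilde_nonneg hd hC) (Atilde_nonneg hd hC)) (by positivity)

theorem measurable_energy_Atilde :
    Measurable fun r ↦ ∫ z₁ : EuclideanSpace ℝ (Fin d), ∫ z₂ : EuclideanSpace ℝ (Fin d),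
        Atilde d C t₀ x₀ ε h z₁ r * Atilde d C t₀ x₀ ε h z₂ r * ‖z₁ - z₂‖ ^ (-β) := by
  refine (StronglyMeasurable.integral_prod_right' (f := fun
    p : ℝ × EuclideanSpace ℝ (Fin d) ↦ ∫ z₂ : EuclideanSpace ℝ (Fin d),
      Atilde d C t₀ x₀ ε h p.2 p.1 * Atilde d C t₀ x₀ ε h z₂ p.1 * ‖p.2 - z₂‖ ^ (-β))
    (StronglyMeasurable.integral_prod_right' (f := fun
    q : (ℝ × EuclideanSpace ℝ (Fin d)) × EuclideanSpace ℝ (Fin d) ↦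
      Atilde d C t₀ x₀ ε h q.1.2 q.1.1 * Atilde d C t₀ x₀ ε h q.2 q.1.1 *
        ‖q.1.2 - q.2‖ ^ (-β)) (Measurable.stronglyMeasurable ?_))).measurable
  refine Measurable.mul (Measurable.mul ?_ ?_) (Measurable.pow_const (by fun_prop) _)
  · exact measurable_Atilde.comp (f := fun
      q : (ℝ × EuclideanSpace ℝ (Fin d)) × EuclideanSpace ℝ (Fin d) ↦ (q.1.2, q.1.1))
      (by fun_prop)
  · exact measurable_Atilde.comp (f := fun
      q : (ℝ × EuclideanSpace ℝ (Fin d)) × EuclideanSpace ℝ (Fin d) ↦ (q.2, q.1.1))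
      (by fun_prop)

theorem msq_le (hd : 1 ≤ d) (hβ0 : 0 < β) (hβ : β < d) (hC : 0 < C) (hh : 0 < h)
    (hhε : h ^ 2 ≤ ε / 2) :
    msq d C β t₀ x₀ ε h ≤ 2 * (((Real.pi * C) ^ ((d : ℝ) / 2)) ^ 2 *
        volume.real (ball (0 : EuclideanSpace ℝ (Fin d)) 1) *
        ((∫ x in ball (0 : EuclideanSpace ℝ (Fin d)) 1, ‖x‖ ^ (-β)) +
          volume.real (ball (0 : EuclideanSpace ℝ (Fin d)) 1))) *
      ε ^ (2 * (d : ℝ) - β + 1) := by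
  have hε : 0 < ε := by nlinarith
  have hpi := Real.pi_pos
  have hP : 0 ≤ ∫ x in ball (0 : EuclideanSpace ℝ (Fin d)) 1, ‖x‖ ^ (-β) :=
    integral_nonneg fun x ↦ by positivity
  rw [msq, div_le_iff₀ (by positivity), rpow_two_mul_sub_add_one hε]
  refine (Real.le_norm_self _).trans ((norm_setIntegral_le_of_norm_le_const measure_Icc_lt_top
    fun r _ ↦ (Real.norm_of_nonneg (energy_Atilde_nonneg hd hC r)).trans_le
      (energy_Atilde_le hd hβ0 hβ hC hε r)).trans ?_)
  rw [Real.volume_real_Icc_of_le (by nlinarith)]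
  refine (mul_le_mul_of_nonneg_left (show t₀ + ε + h ^ 2 - t₀ ≤ 2 * ε by linarith)
    (by positivity)).trans_eq ?_
  ring

theorem le_energy_Atilde (hd : 1 ≤ d) (hβ0 : 0 < β) (hβ : β < d) (hC : 0 < C) (hh : 0 < h)
    (hhε : h ≤ ε / 2) {r : ℝ} (hr : r ∈ Icc (t₀ + h ^ 2) (t₀ + ε)) :
    (volume.real (ball (0 : EuclideanSpace ℝ (Fin d)) 1) * Real.exp (-1 / C) * h ^ 2 *
        volume.real (ball x₀ (ε / 2))) ^ 2 * ε ^ (-β) ≤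
      ∫ z₁ : EuclideanSpace ℝ (Fin d), ∫ z₂ : EuclideanSpace ℝ (Fin d),
        Atilde d C t₀ x₀ ε h z₁ r * Atilde d C t₀ x₀ ε h z₂ r * ‖z₁ - z₂‖ ^ (-β) :=
  le_energy (f := fun z ↦ Atilde d C t₀ x₀ ε h z r)
    (M := (Real.pi * C) ^ ((d : ℝ) / 2) * h ^ 2) hd hβ0 hβ (by linarith)
    (integrable_Atilde_and_integral_le hd hC).1
    (measurable_Atilde.comp (measurable_id.prodMk measurable_const))
    (fun _ ↦ Atilde_nonneg hd hC) (fun _ ↦ Atilde_le hd hC) (by positivity)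
    fun _ hz ↦ le_Atilde hd hC hh hhε hr hz

theorem mul_sub_le_setIntegral_Icc {J : ℝ → ℝ} {B L a b p q : ℝ} (hJm : Measurable J)
    (hJ0 : ∀ r, 0 ≤ J r) (hJB : ∀ r, J r ≤ B) (ha : p ≤ a) (hab : a ≤ b) (hb : b ≤ q)
    (hL : ∀ r ∈ Icc a b, L ≤ J r) :
    (b - a) * L ≤ ∫ r in Icc p q, J r := by
  have hint : IntegrableOn J (Icc p q) :=
    Measure.integrableOn_of_bounded measure_Icc_lt_top.ne hJm.aestronglyMeasurable
      (ae_of_all _ fun r ↦ (Real.norm_of_nonneg (hJ0 r)).trans_le (hJB r))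
  have hsub : Icc a b ⊆ Icc p q := Icc_subset_Icc ha hb
  calc (b - a) * L
      = ∫ _ in Icc a b, L := by
        rw [setIntegral_const, Real.volume_real_Icc_of_le hab, smul_eq_mul]
    _ ≤ ∫ r in Icc a b, J r :=
        setIntegral_mono_on (integrableOn_const measure_Icc_lt_top.ne) (hint.mono_set hsub)
          measurableSet_Icc hL
    _ ≤ ∫ r in Icc p q, J r :=
        setIntegral_mono_set hint (ae_of_all _ hJ0) hsub.eventuallyLE

theorem le_msq (hd : 1 ≤ d) (hβ0 : 0 < β) (hβ : β < d) (hC : 0 < C) (hh : 0 < h)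
    (hhε : h ≤ ε / 2) (hh2 : h ^ 2 ≤ ε / 2) :
    (volume.real (ball (0 : EuclideanSpace ℝ (Fin d)) 1) * Real.exp (-1 / C) *
        ((1 / 2) ^ d * volume.real (ball (0 : EuclideanSpace ℝ (Fin d)) 1))) ^ 2 / 2 *
      ε ^ (2 * (d : ℝ) - β + 1) ≤ msq d C β t₀ x₀ ε h := by
  have hε : 0 < ε := by linarith
  rw [msq, le_div_iff₀ (by positivity), rpow_two_mul_sub_add_one hε]
  refine le_trans ?_ (mul_sub_le_setIntegral_Icc (a := t₀ + h ^ 2) (b := t₀ + ε)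
    measurable_energy_Atilde (fun r ↦ energy_Atilde_nonneg hd hC r)
    (fun r ↦ energy_Atilde_le hd hβ0 hβ hC hε r) (by nlinarith) (by linarith) (by nlinarith)
    fun r hr ↦ le_energy_Atilde hd hβ0 hβ hC hh hhε hr)
  refine le_trans (le_of_eq ?_) (mul_le_mul_of_nonneg_right
    (show ε / 2 ≤ t₀ + ε - (t₀ + h ^ 2) by linarith) (by positivity))
  rw [volume_real_ball_eq (ε := ε / 2) (by positivity), div_eq_mul_one_div ε 2, mul_pow ε]
  ring

end Msq

/-- With `ε = h^ϱ`, there are `K ≥ 1` and `h₀ ∈ (0,1)`, depending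
only on `d, β, ϱ, C`, such that `K⁻¹ h^{ϱ(2d−β+1)} ≤ m²(h) ≤ K h^{ϱ(2d−β+1)}`
for all `h ∈ (0,h₀)`. -/
theorem stmt_8 (d : ℕ) (hd : 1 ≤ d) (β C ϱ : ℝ) (hβ0 : 0 < β)
    (hβd : β < min (d : ℝ) 2) (hC : 0 < C) (hϱ : ϱ ∈ Set.Ioo (0 : ℝ) 1) :
    ∃ K h₀ : ℝ, 1 ≤ K ∧ h₀ ∈ Set.Ioo (0 : ℝ) 1 ∧
      ∀ t₀ : ℝ, 0 ≤ t₀ → ∀ x₀ : EuclideanSpace ℝ (Fin d),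
        ∀ h ∈ Set.Ioo (0 : ℝ) h₀,
          K⁻¹ * h ^ (ϱ * (2 * d - β + 1)) ≤ msq d C β t₀ x₀ (h ^ ϱ) h ∧
          msq d C β t₀ x₀ (h ^ ϱ) h ≤ K * h ^ (ϱ * (2 * d - β + 1)) := by
  have hβ : β < d := hβd.trans_le (min_le_left _ _)
  have hpi := Real.pi_pos
  set v := volume.real (ball (0 : EuclideanSpace ℝ (Fin d)) 1)
  set P := ∫ x in ball (0 : EuclideanSpace ℝ (Fin d)) 1, ‖x‖ ^ (-β)
  set A := 2 * (((Real.pi * C) ^ ((d : ℝ) / 2)) ^ 2 * v * (P + v))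
  set a := (v * Real.exp (-1 / C) * ((1 / 2) ^ d * v)) ^ 2 / 2
  have hv0 : 0 < v :=
    ENNReal.toReal_pos (measure_ball_pos _ _ one_pos).ne' measure_ball_lt_top.ne
  have hP0 : 0 ≤ P := integral_nonneg fun x ↦ by positivity
  have hA0 : 0 ≤ A := by positivity
  have ha0 : 0 < a := by positivity
  have hϱ1 : 0 < 1 - ϱ := sub_pos.2 hϱ.2
  refine ⟨1 + A + a⁻¹, (1 / 2) ^ (1 - ϱ)⁻¹, by linarith [inv_pos.2 ha0],
    ⟨by positivity, Real.rpow_lt_one (by norm_num) (by norm_num) (inv_pos.2 hϱ1)⟩,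
    fun t₀ _ x₀ h hh ↦ ?_⟩
  have hh0 : 0 < h := hh.1
  have hh1 : h < 1 :=
    hh.2.trans (Real.rpow_lt_one (by norm_num) (by norm_num) (inv_pos.2 hϱ1))
  have hhε : h ≤ h ^ ϱ / 2 := by
    have hlt : h ^ (1 - ϱ) ≤ 1 / 2 :=
      (Real.le_rpow_inv_iff_of_pos hh0.le (by norm_num) hϱ1).1 hh.2.le
    calc h = h ^ ϱ * h ^ (1 - ϱ) := by
          rw [← Real.rpow_add hh0, add_sub_cancel, Real.rpow_one]
      _ ≤ h ^ ϱ * (1 / 2) := mul_le_mul_of_nonneg_left hlt (by positivity)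
      _ = h ^ ϱ / 2 := by ring
  have hh2 : h ^ 2 ≤ h ^ ϱ / 2 := by nlinarith
  rw [Real.rpow_mul hh0.le]
  constructor
  · refine le_trans (mul_le_mul_of_nonneg_right ?_ (by positivity))
      (le_msq hd hβ0 hβ hC hh0 hhε hh2)
    exact inv_le_of_inv_le₀ ha0 (by linarith)
  · refine (msq_le hd hβ0 hβ hC hh0 hh2).trans (mul_le_mul_of_nonneg_right ?_ (by positivity))
    linarith [inv_pos.2 ha0]
end

section
/- Fix an integer d ≥ 1, β ∈ (0,d) and C > 0. There exists a constant K, depending only on d, β and C, such that for all ε ∈ (0,1], all 0 < t₂ ≤ t₁ ≤ ε², and all a₁, a₂ ∈ ℝ^d, t₂^{−1} ∫_{ℝ^d} ∫_{ℝ^d} ( ∫_{B(a₁,ε)} t₁^{−1} ‖y−z₁‖ Γ_C(y−z₁, t₁) dy ) exp(−‖z₂−a₂‖²/(2t₂)) ‖z₁−z₂‖^{−β} dz₁ dz₂ ≤ K ε^{2d−1} t₁^{−(1+β)/2} t₂^{−1/2}. -/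
open MeasureTheory

section RieszGaussian

variable {V : Type*} [NormedAddCommGroup V] [InnerProductSpace ℝ V] [FiniteDimensional ℝ V]
  [MeasurableSpace V] [BorelSpace V]

/-- Lower Lebesgue integral form of the Gaussian integral on a Euclidean space. -/
lemma lintegral_exp_neg_mul_sq_norm {b : ℝ} (hb : 0 < b) :
    ∫⁻ v : V, ENNReal.ofReal (Real.exp (-b * ‖v‖ ^ 2)) =
      ENNReal.ofReal ((Real.pi / b) ^ (Module.finrank ℝ V / 2 : ℝ)) := by
  have h := GaussianFourier.integral_rexp_neg_mul_sq_norm (V := V) hb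
  rw [← h, ofReal_integral_eq_lintegral_ofReal _ (ae_of_all _ fun v => (Real.exp_pos _).le)]
  by_contra hni
  rw [integral_undef hni] at h
  have : 0 < (Real.pi / b) ^ (Module.finrank ℝ V / 2 : ℝ) := by positivity
  exact this.ne h

/-- Dilation formula for the lower Lebesgue integral. -/
lemma lintegral_comp_smul_of_pos (f : V → ENNReal) {r : ℝ} (hr : 0 < r) :
    ∫⁻ x : V, f x = ENNReal.ofReal (r ^ Module.finrank ℝ V) * ∫⁻ x : V, f (r • x) := by
  have hmap := Measure.map_addHaar_smul (volume : Measure V) hr.ne'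
  have hemb : MeasurableEmbedding (fun x : V => r • x) :=
    (Homeomorph.smulOfNeZero r hr.ne').measurableEmbedding
  rw [← hemb.lintegral_map, hmap, lintegral_smul_measure, smul_eq_mul, ← mul_assoc,
    ← ENNReal.ofReal_mul (by positivity), abs_of_pos (by positivity),
    mul_inv_cancel₀ (by positivity), ENNReal.ofReal_one, one_mul]

/-- A Riesz kernel of order less than the dimension has finite mass on the unit ball. -/
lemma lintegral_ball_norm_rpow_neg_lt_top {β : ℝ} (hβ : β < Module.finrank ℝ V)
    (hV : 1 ≤ Module.finrank ℝ V) :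
    ∫⁻ u in Metric.ball (0 : V) 1, ENNReal.ofReal (‖u‖ ^ (-β)) < ⊤ := by
  have : Nontrivial V := Module.finrank_pos_iff.mp hV
  have h : IntegrableOn (fun u : V => ‖u‖ ^ (-β)) (Metric.ball 0 1) := by
    rw [integrableOn_fun_norm_addHaar (volume : Measure V) (f := fun s => s ^ (-β))]
    have h1 : IntegrableOn (fun y : ℝ => y ^ ((Module.finrank ℝ V : ℝ) - 1 - β))
        (Set.Ioo 0 1) := by
      rw [intervalIntegral.integrableOn_Ioo_rpow_iff one_pos]
      linarith
    refine h1.congr_fun (fun y hy => ?_) measurableSet_Ioo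
    simp only [smul_eq_mul]
    rw [← Real.rpow_natCast, ← Real.rpow_add hy.1, Nat.cast_sub hV]
    simp [sub_eq_add_neg]
  exact h.lintegral_lt_top

lemma lintegral_ball_norm_sub_rpow_neg (β : ℝ) (x : V) {r : ℝ} (hr : 0 < r) :
    ∫⁻ u in Metric.ball x r, ENNReal.ofReal (‖u - x‖ ^ (-β)) =
      ENNReal.ofReal (r ^ (Module.finrank ℝ V - β)) *
        ∫⁻ u in Metric.ball (0 : V) 1, ENNReal.ofReal (‖u‖ ^ (-β)) := by
  rw [← lintegral_indicator Metric.isOpen_ball.measurableSet,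
    ← lintegral_indicator Metric.isOpen_ball.measurableSet,
    ← lintegral_add_right_eq_self _ x, lintegral_comp_smul_of_pos _ hr,
    sub_eq_add_neg, Real.rpow_add hr, Real.rpow_natCast, ENNReal.ofReal_mul (by positivity),
    mul_assoc]
  congr 1
  rw [← lintegral_const_mul' _ _ ENNReal.ofReal_ne_top]
  congr 1 with u
  have hiff : r • u + x ∈ Metric.ball x r ↔ u ∈ Metric.ball (0 : V) 1 := by
    simp [norm_smul, abs_of_pos hr, hr]
  by_cases hu : u ∈ Metric.ball (0 : V) 1
  · rw [Set.indicator_of_mem (hiff.mpr hu), Set.indicator_of_mem hu, add_sub_cancel_right,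
      norm_smul, Real.norm_of_nonneg hr.le, Real.mul_rpow hr.le (norm_nonneg _),
      ENNReal.ofReal_mul (by positivity)]
  · rw [Set.indicator_of_notMem (mt hiff.mp hu), Set.indicator_of_notMem hu, mul_zero]

/-- Uniform bound for the Riesz potential of a Gaussian of variance proportional to `t`. -/
lemma exists_lintegral_gaussian_mul_riesz_le {β b : ℝ} (hβ0 : 0 ≤ β)
    (hβ : β < Module.finrank ℝ V) (hV : 1 ≤ Module.finrank ℝ V) (hb : 0 < b) :
    ∃ M : ℝ, 0 < M ∧ ∀ t : ℝ, 0 < t → ∀ x y : V,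
      ∫⁻ z, ENNReal.ofReal (Real.exp (-(b / t) * ‖y - z‖ ^ 2)) *
          ENNReal.ofReal (‖z - x‖ ^ (-β)) ≤
        ENNReal.ofReal (M * t ^ ((Module.finrank ℝ V - β) / 2)) := by
  have hI := (lintegral_ball_norm_rpow_neg_lt_top hβ hV).ne
  set I := ∫⁻ u in Metric.ball (0 : V) 1, ENNReal.ofReal (‖u‖ ^ (-β)) with hIdef
  refine ⟨I.toReal + (Real.pi / b) ^ (Module.finrank ℝ V / 2 : ℝ), by positivity,
    fun t ht x y => ?_⟩
  have hpt : ∀ z : V, ENNReal.ofReal (Real.exp (-(b / t) * ‖y - z‖ ^ 2)) *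
        ENNReal.ofReal (‖z - x‖ ^ (-β)) ≤
      (Metric.ball x (√t)).indicator (fun z => ENNReal.ofReal (‖z - x‖ ^ (-β))) z +
        ENNReal.ofReal (t ^ (-β / 2)) *
          ENNReal.ofReal (Real.exp (-(b / t) * ‖y - z‖ ^ 2)) := by
    intro z
    by_cases hz : z ∈ Metric.ball x (√t)
    · rw [Set.indicator_of_mem hz]
      refine le_add_right (mul_le_of_le_one_left zero_le ?_)
      rw [ENNReal.ofReal_le_one, Real.exp_le_one_iff, neg_mul, neg_nonpos]
      positivity
    · rw [Set.indicator_of_notMem hz, zero_add, mul_comm]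
      gcongr
      have hz' : √t ≤ ‖z - x‖ := by
        simpa [dist_eq_norm] using hz
      calc ‖z - x‖ ^ (-β) ≤ √t ^ (-β) :=
            Real.rpow_le_rpow_of_nonpos (Real.sqrt_pos.mpr ht) hz' (by linarith)
        _ = t ^ (-β / 2) := by
            rw [Real.sqrt_eq_rpow, ← Real.rpow_mul ht.le]
            ring_nf
  have hgauss : ∫⁻ z : V, ENNReal.ofReal (Real.exp (-(b / t) * ‖y - z‖ ^ 2)) =
      ENNReal.ofReal ((Real.pi / (b / t)) ^ (Module.finrank ℝ V / 2 : ℝ)) := by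
    rw [lintegral_sub_left_eq_self
      (fun z : V => ENNReal.ofReal (Real.exp (-(b / t) * ‖z‖ ^ 2))) y]
    exact lintegral_exp_neg_mul_sq_norm (by positivity)
  refine (lintegral_mono hpt).trans ?_
  rw [lintegral_add_right _ (by fun_prop), lintegral_indicator Metric.isOpen_ball.measurableSet,
    lintegral_ball_norm_sub_rpow_neg β x (Real.sqrt_pos.mpr ht),
    lintegral_const_mul' _ _ ENNReal.ofReal_ne_top, hgauss, ← hIdef,
    ← ENNReal.ofReal_toReal hI, ← ENNReal.ofReal_mul (by positivity),
    ← ENNReal.ofReal_mul (by positivity), ← ENNReal.ofReal_add (by positivity) (by positivity),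
    ENNReal.toReal_ofReal (by positivity)]
  refine ENNReal.ofReal_le_ofReal (le_of_eq ?_)
  have e1 : √t ^ ((Module.finrank ℝ V : ℝ) - β) =
      t ^ (((Module.finrank ℝ V : ℝ) - β) / 2) := by
    rw [Real.sqrt_eq_rpow, ← Real.rpow_mul ht.le]
    ring_nf
  have e2 : (Real.pi / (b / t)) ^ (Module.finrank ℝ V / 2 : ℝ) =
      (Real.pi / b) ^ (Module.finrank ℝ V / 2 : ℝ) * t ^ (Module.finrank ℝ V / 2 : ℝ) := by
    rw [← Real.mul_rpow (by positivity) ht.le]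
    congr 1
    field_simp
  have e3 : t ^ (((Module.finrank ℝ V : ℝ) - β) / 2) =
      t ^ (-β / 2) * t ^ (Module.finrank ℝ V / 2 : ℝ) := by
    rw [← Real.rpow_add ht]
    ring_nf
  rw [e1, e2, add_mul, e3]
  ring

end RieszGaussian

/-- Tonelli bound for a triple integral whose inner integral is uniformly bounded. -/
lemma lintegral_lintegral_mul_le {X Y Z : Type*} [MeasurableSpace X] [MeasurableSpace Y]
    [MeasurableSpace Z] {μ : Measure X} {ν : Measure Y} {ρ : Measure Z} [SFinite μ] [SFinite ν]
    [SFinite ρ] {G : Y → X → ENNReal} {E : Z → ENNReal} {P : X → Z → ENNReal}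
    (hG : Measurable (Function.uncurry G)) (hE : Measurable E)
    (hP : Measurable (Function.uncurry P)) {M : ENNReal}
    (hM : ∀ y z, ∫⁻ x, G y x * P x z ∂μ ≤ M) :
    ∫⁻ x, ∫⁻ z, (∫⁻ y, G y x ∂ν) * E z * P x z ∂ρ ∂μ ≤
      M * ν Set.univ * ∫⁻ z, E z ∂ρ := by
  have hGi : Measurable fun x => ∫⁻ y, G y x ∂ν := hG.lintegral_prod_left'
  have hP' : ∀ z, Measurable fun x => P x z := fun z => hP.comp measurable_prodMk_right
  rw [lintegral_lintegral_swap (((hGi.comp measurable_fst).mul (hE.comp measurable_snd)).mul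
    hP).aemeasurable, ← lintegral_const_mul _ hE]
  refine lintegral_mono fun z => ?_
  calc ∫⁻ x, (∫⁻ y, G y x ∂ν) * E z * P x z ∂μ
      = (∫⁻ x, ∫⁻ y, G y x * P x z ∂ν ∂μ) * E z := by
        rw [← lintegral_mul_const]
        · refine lintegral_congr fun x => ?_
          rw [lintegral_mul_const _ (show Measurable fun y => G y x from
            hG.comp measurable_prodMk_right)]
          ring
        · exact Measurable.lintegral_prod_left'
            (f := fun p : Y × X => G p.1 p.2 * P p.2 z) (hG.mul ((hP' z).comp measurable_snd))
    _ = (∫⁻ y, ∫⁻ x, G y x * P x z ∂μ ∂ν) * E z := by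
        rw [lintegral_lintegral_swap]
        exact ((hG.comp measurable_swap).mul ((hP' z).comp measurable_fst)).aemeasurable
    _ ≤ M * ν Set.univ * E z := by
        gcongr
        exact (lintegral_mono fun y => hM y z).trans_eq (lintegral_const _)

/-- The linear factor in the gradient bound is absorbed by half of the Gaussian exponent. -/
lemma inv_mul_norm_mul_GammaKer_le {d : ℕ} {C t : ℝ} (hC : 0 < C) (ht : 0 < t)
    (x : EuclideanSpace ℝ (Fin d)) :
    t⁻¹ * ‖x‖ * GammaKer d C x t ≤
      (1 + C / 2) * t ^ (-(1 + d : ℝ) / 2) * Real.exp (-((2 * C)⁻¹ / t) * ‖x‖ ^ 2) := by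
  set q := (2 * C)⁻¹ / t * ‖x‖ ^ 2 with hq
  have hq0 : 0 ≤ q := by positivity
  have hs : (√t)⁻¹ * ‖x‖ ≤ (1 + C / 2) * Real.exp q := by
    have h1 : ((√t)⁻¹ * ‖x‖) ^ 2 = 2 * C * q := by
      rw [mul_pow, inv_pow, Real.sq_sqrt ht.le, hq]
      field_simp
    have h2 := Real.add_one_le_exp q
    have h3 : (√t)⁻¹ * ‖x‖ ≤ q + C / 2 := by
      refine abs_le_of_sq_le_sq' ?_ (by positivity) |>.2
      rw [h1]
      nlinarith [sq_nonneg (q - C / 2)]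
    nlinarith
  have e1 : Real.exp (-‖x‖ ^ 2 / (C * t)) = Real.exp (-q) * Real.exp (-q) := by
    rw [← Real.exp_add, hq]
    congr 1
    field_simp
    ring
  have e2 : t⁻¹ * t ^ (-(d : ℝ) / 2) = t ^ (-(1 + d : ℝ) / 2) * (√t)⁻¹ := by
    rw [Real.sqrt_eq_rpow, ← Real.rpow_neg_one, ← Real.rpow_neg ht.le, ← Real.rpow_add ht,
      ← Real.rpow_add ht]
    ring_nf
  calc t⁻¹ * ‖x‖ * GammaKer d C x t
      = (t⁻¹ * t ^ (-(d : ℝ) / 2)) * ‖x‖ * (Real.exp (-q) * Real.exp (-q)) := by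
        rw [GammaKer, e1]
        ring
    _ = t ^ (-(1 + d : ℝ) / 2) * ((√t)⁻¹ * ‖x‖) * (Real.exp (-q) * Real.exp (-q)) := by
        rw [e2]
        ring
    _ ≤ t ^ (-(1 + d : ℝ) / 2) * ((1 + C / 2) * Real.exp q) *
          (Real.exp (-q) * Real.exp (-q)) := by gcongr
    _ = (1 + C / 2) * t ^ (-(1 + d : ℝ) / 2) * Real.exp (-q) * (Real.exp q * Real.exp (-q)) := by
        ring
    _ = (1 + C / 2) * t ^ (-(1 + d : ℝ) / 2) * Real.exp (-((2 * C)⁻¹ / t) * ‖x‖ ^ 2) := by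
        rw [← Real.exp_add, add_neg_cancel, Real.exp_zero, mul_one, hq, neg_mul]

/-- the term `U₁`: there is `K` depending only on `d, β, C`
such that for all `ε ∈ (0,1]`, `0 < t₂ ≤ t₁ ≤ ε²` and `a₁, a₂ ∈ ℝ^d`,
`t₂^{−1} ∫∫ (∫_{B(a₁,ε)} t₁^{−1}‖y−z₁‖ Γ_C(y−z₁,t₁) dy) e^{−‖z₂−a₂‖²/(2t₂)}
  ‖z₁−z₂‖^{−β} dz₁ dz₂ ≤ K ε^{2d−1} t₁^{−(1+β)/2} t₂^{−1/2}`. -/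
theorem stmt_10 (d : ℕ) (hd : 1 ≤ d) (β C : ℝ) (hβ0 : 0 < β) (hβd : β < d)
    (hC : 0 < C) :
    ∃ K : ℝ, 0 < K ∧ ∀ ε ∈ Set.Ioc (0 : ℝ) 1, ∀ t₁ t₂ : ℝ,
      0 < t₂ → t₂ ≤ t₁ → t₁ ≤ ε ^ 2 → ∀ a₁ a₂ : EuclideanSpace ℝ (Fin d),
        t₂⁻¹ * (∫ z₁ : EuclideanSpace ℝ (Fin d), ∫ z₂ : EuclideanSpace ℝ (Fin d),
            (∫ y in Metric.ball a₁ ε, t₁⁻¹ * ‖y - z₁‖ * GammaKer d C (y - z₁) t₁) *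
              Real.exp (-‖z₂ - a₂‖ ^ 2 / (2 * t₂)) * ‖z₁ - z₂‖ ^ (-β)) ≤
          K * ε ^ (2 * d - 1) * t₁ ^ (-(1 + β) / 2) * t₂ ^ (-(1 : ℝ) / 2) := by
  obtain ⟨M, hM0, hM⟩ := exists_lintegral_gaussian_mul_riesz_le
    (V := EuclideanSpace ℝ (Fin d)) (β := β) (b := (2 * C)⁻¹) hβ0.le (by simpa using hβd)
    (by simpa using hd) (by positivity)
  simp only [finrank_euclideanSpace_fin] at hM
  have hvtop : volume (Metric.ball (0 : EuclideanSpace ℝ (Fin d)) 1) ≠ ⊤ :=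
    measure_ball_lt_top.ne
  have hvpos : 0 < (volume (Metric.ball (0 : EuclideanSpace ℝ (Fin d)) 1)).toReal :=
    ENNReal.toReal_pos (Metric.measure_ball_pos _ _ one_pos).ne' hvtop
  set v := (volume (Metric.ball (0 : EuclideanSpace ℝ (Fin d)) 1)).toReal with hv
  refine ⟨(1 + C / 2) * M * v * (2 * Real.pi) ^ ((d : ℝ) / 2), by positivity, ?_⟩
  rintro ε ⟨hε, -⟩ t₁ t₂ ht₂ ht₂₁ ht₁ε a₁ a₂
  have ht₁ : 0 < t₁ := ht₂.trans_le ht₂₁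
  set A := (1 + C / 2) * t₁ ^ (-(1 + d : ℝ) / 2) with hA
  have hA0 : 0 < A := by positivity
  have hball : volume (Metric.ball a₁ ε) = ENNReal.ofReal (ε ^ d * v) := by
    rw [Measure.addHaar_ball_of_pos _ _ hε, finrank_euclideanSpace_fin,
      ENNReal.ofReal_mul (by positivity), hv, ENNReal.ofReal_toReal hvtop]
  have hgauss : ∫⁻ z : EuclideanSpace ℝ (Fin d),
      ENNReal.ofReal (Real.exp (-‖z - a₂‖ ^ 2 / (2 * t₂))) =
        ENNReal.ofReal ((2 * Real.pi * t₂) ^ ((d : ℝ) / 2)) := by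
    rw [lintegral_sub_right_eq_self (fun z : EuclideanSpace ℝ (Fin d) =>
      ENNReal.ofReal (Real.exp (-‖z‖ ^ 2 / (2 * t₂)))) a₂]
    have h := lintegral_exp_neg_mul_sq_norm (V := EuclideanSpace ℝ (Fin d))
      (b := (2 * t₂)⁻¹) (by positivity)
    rw [finrank_euclideanSpace_fin, div_inv_eq_mul] at h
    rw [show 2 * Real.pi * t₂ = Real.pi * (2 * t₂) by ring, ← h]
    refine lintegral_congr fun z => ?_
    rw [neg_div, neg_mul, div_eq_inv_mul]
  have hmain : (∫ z₁ : EuclideanSpace ℝ (Fin d), ∫ z₂ : EuclideanSpace ℝ (Fin d),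
      (∫ y in Metric.ball a₁ ε, t₁⁻¹ * ‖y - z₁‖ * GammaKer d C (y - z₁) t₁) *
        Real.exp (-‖z₂ - a₂‖ ^ 2 / (2 * t₂)) * ‖z₁ - z₂‖ ^ (-β)) ≤
      A * (M * t₁ ^ (((d : ℝ) - β) / 2)) * (ε ^ d * v) *
        (2 * Real.pi * t₂) ^ ((d : ℝ) / 2) := by
    refine (le_abs_self _).trans ?_
    rw [← ENNReal.ofReal_le_ofReal_iff (by positivity), ← Real.enorm_eq_ofReal_abs]
    calc _ ≤ ∫⁻ z₁ : EuclideanSpace ℝ (Fin d), ∫⁻ z₂ : EuclideanSpace ℝ (Fin d),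
          (∫⁻ y in Metric.ball a₁ ε, ENNReal.ofReal A *
            ENNReal.ofReal (Real.exp (-((2 * C)⁻¹ / t₁) * ‖y - z₁‖ ^ 2))) *
          ENNReal.ofReal (Real.exp (-‖z₂ - a₂‖ ^ 2 / (2 * t₂))) *
          ENNReal.ofReal (‖z₁ - z₂‖ ^ (-β)) := by
          refine (enorm_integral_le_lintegral_enorm _).trans (lintegral_mono fun z₁ => ?_)
          refine (enorm_integral_le_lintegral_enorm _).trans (lintegral_mono fun z₂ => ?_)
          simp only [enorm_mul]
          rw [Real.enorm_of_nonneg (Real.exp_pos _).le,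
            Real.enorm_of_nonneg (Real.rpow_nonneg (norm_nonneg _) _)]
          gcongr
          refine (enorm_integral_le_lintegral_enorm _).trans (lintegral_mono fun y => ?_)
          have h0 : 0 ≤ t₁⁻¹ * ‖y - z₁‖ * GammaKer d C (y - z₁) t₁ := by
            unfold GammaKer
            positivity
          rw [Real.enorm_of_nonneg h0, ← ENNReal.ofReal_mul hA0.le]
          exact ENNReal.ofReal_le_ofReal (inv_mul_norm_mul_GammaKer_le hC ht₁ _)
      _ ≤ ENNReal.ofReal (A * (M * t₁ ^ (((d : ℝ) - β) / 2))) *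
            (volume.restrict (Metric.ball a₁ ε)) Set.univ *
            ∫⁻ z : EuclideanSpace ℝ (Fin d),
              ENNReal.ofReal (Real.exp (-‖z - a₂‖ ^ 2 / (2 * t₂))) := by
          refine lintegral_lintegral_mul_le
            (G := fun y z₁ : EuclideanSpace ℝ (Fin d) => ENNReal.ofReal A *
              ENNReal.ofReal (Real.exp (-((2 * C)⁻¹ / t₁) * ‖y - z₁‖ ^ 2)))
            (P := fun z₁ z₂ : EuclideanSpace ℝ (Fin d) => ENNReal.ofReal (‖z₁ - z₂‖ ^ (-β)))
            (by unfold Function.uncurry; fun_prop) (by fun_prop)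
            (by unfold Function.uncurry; fun_prop) fun y z => ?_
          simp only [mul_assoc]
          rw [lintegral_const_mul' _ _ ENNReal.ofReal_ne_top, ENNReal.ofReal_mul hA0.le]
          gcongr
          exact hM t₁ ht₁ z y
      _ = _ := by
          rw [Measure.restrict_apply_univ, hball, hgauss, ← ENNReal.ofReal_mul (by positivity),
            ← ENNReal.ofReal_mul (by positivity)]
  have e1 : t₁ ^ (-(1 + d : ℝ) / 2) * t₁ ^ (((d : ℝ) - β) / 2) = t₁ ^ (-(1 + β) / 2) := by
    rw [← Real.rpow_add ht₁]
    ring_nf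
  have e2 : t₂⁻¹ * t₂ ^ ((d : ℝ) / 2) = t₂ ^ (-(1 : ℝ) / 2) * t₂ ^ (((d : ℝ) - 1) / 2) := by
    rw [← Real.rpow_neg_one, ← Real.rpow_add ht₂, ← Real.rpow_add ht₂]
    ring_nf
  have e3 : t₂ ^ (((d : ℝ) - 1) / 2) ≤ ε ^ (d - 1) := by
    have hd' : (1 : ℝ) ≤ d := by exact_mod_cast hd
    calc t₂ ^ (((d : ℝ) - 1) / 2) ≤ (ε ^ 2) ^ (((d : ℝ) - 1) / 2) :=
          Real.rpow_le_rpow ht₂.le (ht₂₁.trans ht₁ε) (by linarith)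
      _ = ε ^ (d - 1) := by
          rw [← Real.rpow_natCast, ← Real.rpow_natCast, ← Real.rpow_mul hε.le, Nat.cast_sub hd]
          congr 1
          push_cast
          ring
  have e4 : ε ^ (2 * d - 1) = ε ^ d * ε ^ (d - 1) := by
    rw [← pow_add]
    congr 1
    omega
  calc _ ≤ t₂⁻¹ * (A * (M * t₁ ^ (((d : ℝ) - β) / 2)) * (ε ^ d * v) *
        (2 * Real.pi * t₂) ^ ((d : ℝ) / 2)) := by gcongr
    _ = (1 + C / 2) * M * v * (2 * Real.pi) ^ ((d : ℝ) / 2) * ε ^ d *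
        (t₁ ^ (-(1 + d : ℝ) / 2) * t₁ ^ (((d : ℝ) - β) / 2)) *
        (t₂⁻¹ * t₂ ^ ((d : ℝ) / 2)) := by
        rw [Real.mul_rpow (by positivity) ht₂.le, hA]
        ring
    _ = (1 + C / 2) * M * v * (2 * Real.pi) ^ ((d : ℝ) / 2) * ε ^ d *
        t₁ ^ (-(1 + β) / 2) * (t₂ ^ (-(1 : ℝ) / 2) * t₂ ^ (((d : ℝ) - 1) / 2)) := by
        rw [e1, e2]
    _ ≤ (1 + C / 2) * M * v * (2 * Real.pi) ^ ((d : ℝ) / 2) * ε ^ d *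
        t₁ ^ (-(1 + β) / 2) * (t₂ ^ (-(1 : ℝ) / 2) * ε ^ (d - 1)) := by gcongr
    _ = _ := by
        rw [e4]
        ring
end

section
/- Fix an integer d ≥ 1, β ∈ (0,d) and C > 0. There exists a constant K, depending only on d, β and C, such that for all ε ∈ (0,1], all 0 < t₂ ≤ t₁ ≤ ε², and all a₁, a₂ ∈ ℝ^d, ∫_{ℝ^d} ∫_{ℝ^d} ( ∫_{B(a₁,ε)} t₁^{−1} ‖y−z₁‖ Γ_C(y−z₁, t₁) dy ) ( ∫_{B(a₂,ε)} t₂^{−1} ‖y−z₂‖ Γ_C(y−z₂, t₂) dy ) ‖z₁−z₂‖^{−β} dz₁ dz₂ ≤ K ε^{2d} t₁^{−(1+β)/2} t₂^{−1/2}. -/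
open MeasureTheory

open scoped ENNReal

theorem lintegral_eq_mul_lintegral_comp_smul {E : Type*} [NormedAddCommGroup E]
    [NormedSpace ℝ E] [FiniteDimensional ℝ E] [MeasurableSpace E] [BorelSpace E]
    (μ : Measure E) [μ.IsAddHaarMeasure] {s : ℝ} (hs : 0 < s) {f : E → ℝ≥0∞}
    (hf : Measurable f) :
    ∫⁻ z, f z ∂μ = ENNReal.ofReal (s ^ Module.finrank ℝ E) * ∫⁻ v, f (s • v) ∂μ := by
  have h : ∫⁻ v, f (s • v) ∂μ = ∫⁻ z, f z ∂(Measure.map (s • ·) μ) :=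
    (lintegral_map hf (measurable_const_smul s)).symm
  have hpos : 0 < s ^ Module.finrank ℝ E := by positivity
  rw [h, Measure.map_addHaar_smul μ hs.ne', lintegral_smul_measure, smul_eq_mul, ← mul_assoc,
    ← ENNReal.ofReal_mul hpos.le, abs_of_pos (inv_pos.2 hpos), mul_inv_cancel₀ hpos.ne',
    ENNReal.ofReal_one, one_mul]

theorem norm_mul_exp_le {C : ℝ} (hC : 0 < C) (r : ℝ) :
    r * Real.exp (-r ^ 2 / C) ≤ 1 + C := by
  have h1 : 1 + r ^ 2 / C ≤ Real.exp (r ^ 2 / C) := by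
    linarith [Real.add_one_le_exp (r ^ 2 / C)]
  have h2 : r ≤ (1 + C) * (1 + r ^ 2 / C) := by
    have h3 : (1 + C) * (1 + r ^ 2 / C) = 1 + C + r ^ 2 / C + r ^ 2 := by
      field_simp
      ring
    have h4 : 0 ≤ r ^ 2 / C := by positivity
    nlinarith [sq_nonneg (r - 1)]
  rw [neg_div, Real.exp_neg, ← div_eq_mul_inv, div_le_iff₀ (Real.exp_pos _)]
  exact h2.trans (by gcongr)

theorem integrable_norm_mul_exp (d : ℕ) {C : ℝ} (hd : 1 ≤ d) (hC : 0 < C) :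
    Integrable (fun v : EuclideanSpace ℝ (Fin d) => ‖v‖ * Real.exp (-‖v‖ ^ 2 / C)) := by
  have : Nonempty (Fin d) := ⟨⟨0, hd⟩⟩
  rw [integrable_fun_norm_addHaar volume (f := fun r : ℝ => r * Real.exp (-r ^ 2 / C))]
  refine (integrableOn_rpow_mul_exp_neg_mul_sq (b := C⁻¹) (inv_pos.2 hC) (s := (d : ℝ))
    (by linarith [(Nat.cast_nonneg d : (0 : ℝ) ≤ d)])).congr_fun (fun r hr => ?_)
    measurableSet_Ioi
  obtain ⟨n, rfl⟩ : ∃ n, d = n + 1 := ⟨d - 1, by omega⟩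
  have : -C⁻¹ * r ^ 2 = -r ^ 2 / C := by field_simp
  simp only [finrank_euclideanSpace_fin, Real.rpow_natCast, smul_eq_mul, Nat.add_sub_cancel, this]
  ring

theorem integrableOn_norm_rpow_ball (d : ℕ) {b : ℝ} (hd : 1 ≤ d) (hb : b < d) :
    IntegrableOn (fun v : EuclideanSpace ℝ (Fin d) => ‖v‖ ^ (-b)) (Metric.ball 0 1) := by
  have : Nonempty (Fin d) := ⟨⟨0, hd⟩⟩
  rw [integrableOn_fun_norm_addHaar volume (f := fun r : ℝ => r ^ (-b))]
  refine ((intervalIntegral.integrableOn_Ioo_rpow_iff (s := (d : ℝ) - 1 - b) one_pos).2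
    (by linarith)).congr_fun (fun r hr => ?_) measurableSet_Ioo
  obtain ⟨n, rfl⟩ : ∃ n, d = n + 1 := ⟨d - 1, by omega⟩
  simp only [finrank_euclideanSpace_fin, smul_eq_mul, Nat.add_sub_cancel]
  rw [← Real.rpow_natCast, ← Real.rpow_add hr.1]
  congr 1
  push_cast
  ring

theorem exists_lintegral_norm_mul_exp_mul_rpow_le (d : ℕ) {b C : ℝ} (hd : 1 ≤ d) (hb0 : 0 ≤ b)
    (hbd : b < d) (hC : 0 < C) :
    ∃ M : ℝ, 0 < M ∧ ∀ y w : EuclideanSpace ℝ (Fin d),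
      ∫⁻ v, ENNReal.ofReal (‖y - v‖ * Real.exp (-‖y - v‖ ^ 2 / C)) *
        ENNReal.ofReal (‖v - w‖ ^ (-b)) ≤ ENNReal.ofReal M := by
  set I := ∫⁻ v : EuclideanSpace ℝ (Fin d),
    ENNReal.ofReal (‖v‖ * Real.exp (-‖v‖ ^ 2 / C)) with hI
  set J := ∫⁻ v : EuclideanSpace ℝ (Fin d),
    (Metric.ball 0 1).indicator (fun v => ENNReal.ofReal (‖v‖ ^ (-b))) v with hJ
  have hIt : I ≠ ∞ := (integrable_norm_mul_exp d hd hC).lintegral_lt_top.ne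
  have hJt : J ≠ ∞ := by
    rw [hJ, lintegral_indicator measurableSet_ball]
    exact (integrableOn_norm_rpow_ball d hd hbd).lintegral_lt_top.ne
  have hT : I + ENNReal.ofReal (1 + C) * J ≠ ∞ :=
    ENNReal.add_ne_top.2 ⟨hIt, ENNReal.mul_ne_top ENNReal.ofReal_ne_top hJt⟩
  refine ⟨(I + ENNReal.ofReal (1 + C) * J).toReal + 1, by positivity, fun y w => ?_⟩
  have key : ∀ v : EuclideanSpace ℝ (Fin d),
      ENNReal.ofReal (‖y - v‖ * Real.exp (-‖y - v‖ ^ 2 / C)) * ENNReal.ofReal (‖v - w‖ ^ (-b)) ≤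
      ENNReal.ofReal (‖y - v‖ * Real.exp (-‖y - v‖ ^ 2 / C)) + ENNReal.ofReal (1 + C) *
        (Metric.ball 0 1).indicator (fun v => ENNReal.ofReal (‖v‖ ^ (-b))) (v - w) := by
    intro v
    by_cases hv : v - w ∈ Metric.ball (0 : EuclideanSpace ℝ (Fin d)) 1
    · rw [Set.indicator_of_mem hv]
      refine le_add_left ?_
      gcongr
      exact norm_mul_exp_le hC _
    · rw [Set.indicator_of_notMem hv, mul_zero, add_zero]
      refine mul_le_of_le_one_right' ?_
      rw [ENNReal.ofReal_le_one]
      refine Real.rpow_le_one_of_one_le_of_nonpos ?_ (by linarith)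
      simpa using hv
  calc _ ≤ _ := lintegral_mono key
    _ = I + ENNReal.ofReal (1 + C) * J := by
      rw [lintegral_add_left (by fun_prop), lintegral_const_mul' _ _ ENNReal.ofReal_ne_top]
      congr 1
      · exact lintegral_sub_left_eq_self
          (fun v => ENNReal.ofReal (‖v‖ * Real.exp (-‖v‖ ^ 2 / C))) y
      · congr 1
        exact lintegral_sub_right_eq_self
          ((Metric.ball 0 1).indicator (fun v => ENNReal.ofReal (‖v‖ ^ (-b)))) w
    _ = ENNReal.ofReal (I + ENNReal.ofReal (1 + C) * J).toReal := (ENNReal.ofReal_toReal hT).symm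
    _ ≤ _ := ENNReal.ofReal_le_ofReal (by linarith)

theorem measurable_norm_mul_gammaKer (d : ℕ) (C t : ℝ) :
    Measurable fun p : EuclideanSpace ℝ (Fin d) × EuclideanSpace ℝ (Fin d) =>
      ENNReal.ofReal (t⁻¹ * ‖p.1 - p.2‖ * GammaKer d C (p.1 - p.2) t) := by
  unfold GammaKer
  fun_prop

theorem norm_mul_gammaKer_smul (d : ℕ) (b C : ℝ) {s : ℝ} (hs : 0 < s)
    (y w v : EuclideanSpace ℝ (Fin d)) :
    s ^ d * ((s ^ 2)⁻¹ * ‖y - s • v‖ * GammaKer d C (y - s • v) (s ^ 2) * ‖s • v - w‖ ^ (-b)) =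
      s ^ (-(1 + b)) * ((‖s⁻¹ • y - v‖ * Real.exp (-‖s⁻¹ • y - v‖ ^ 2 / C)) *
        ‖v - s⁻¹ • w‖ ^ (-b)) := by
  have h1 : ‖y - s • v‖ = s * ‖s⁻¹ • y - v‖ := by
    rw [← Real.norm_of_nonneg hs.le, ← norm_smul, Real.norm_of_nonneg hs.le, smul_sub,
      smul_inv_smul₀ hs.ne']
  have h2 : ‖s • v - w‖ = s * ‖v - s⁻¹ • w‖ := by
    rw [← Real.norm_of_nonneg hs.le, ← norm_smul, Real.norm_of_nonneg hs.le, smul_sub,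
      smul_inv_smul₀ hs.ne']
  have h3 : (s ^ 2) ^ (-(d : ℝ) / 2) = (s ^ d)⁻¹ := by
    rw [← Real.rpow_natCast s 2, ← Real.rpow_mul hs.le, ← Real.rpow_natCast s d,
      ← Real.rpow_neg hs.le]
    congr 1
    push_cast
    ring
  have h4 : -(s * ‖s⁻¹ • y - v‖) ^ 2 / (C * s ^ 2) = -‖s⁻¹ • y - v‖ ^ 2 / C := by
    rw [mul_pow, neg_div, neg_div, mul_comm C, mul_div_mul_left _ _ (by positivity)]
  have h5 : s ^ (-(1 + b)) = s⁻¹ * s ^ (-b) := by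
    rw [neg_add, Real.rpow_add hs, Real.rpow_neg_one]
  rw [GammaKer, h1, h2, h3, h4, h5, Real.mul_rpow hs.le (norm_nonneg _)]
  field_simp

theorem lintegral_norm_mul_gammaKer_mul_rpow_le (d : ℕ) {b C M : ℝ}
    (hM : ∀ y w : EuclideanSpace ℝ (Fin d),
      ∫⁻ v, ENNReal.ofReal (‖y - v‖ * Real.exp (-‖y - v‖ ^ 2 / C)) *
        ENNReal.ofReal (‖v - w‖ ^ (-b)) ≤ ENNReal.ofReal M)
    {t : ℝ} (ht : 0 < t) (y w : EuclideanSpace ℝ (Fin d)) :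
    ∫⁻ z, ENNReal.ofReal (t⁻¹ * ‖y - z‖ * GammaKer d C (y - z) t) *
      ENNReal.ofReal (‖z - w‖ ^ (-b)) ≤ ENNReal.ofReal (t ^ (-(1 + b) / 2) * M) := by
  obtain ⟨s, hs, rfl⟩ : ∃ s : ℝ, 0 < s ∧ t = s ^ 2 :=
    ⟨√t, Real.sqrt_pos.2 ht, (Real.sq_sqrt ht.le).symm⟩
  have hexp : (s ^ 2) ^ (-(1 + b) / 2) = s ^ (-(1 + b)) := by
    rw [← Real.rpow_natCast s 2, ← Real.rpow_mul hs.le]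
    congr 1
    push_cast
    ring
  have hmeas : Measurable fun z : EuclideanSpace ℝ (Fin d) =>
      ENNReal.ofReal ((s ^ 2)⁻¹ * ‖y - z‖ * GammaKer d C (y - z) (s ^ 2)) *
      ENNReal.ofReal (‖z - w‖ ^ (-b)) :=
    ((measurable_norm_mul_gammaKer d C (s ^ 2)).comp measurable_prodMk_left).mul (by fun_prop)
  rw [lintegral_eq_mul_lintegral_comp_smul volume hs hmeas,
    ← lintegral_const_mul' _ _ ENNReal.ofReal_ne_top, finrank_euclideanSpace_fin, hexp,
    ENNReal.ofReal_mul (by positivity)]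
  refine le_trans (le_of_eq ?_) (mul_le_mul_right (hM (s⁻¹ • y) (s⁻¹ • w)) _)
  rw [← lintegral_const_mul' _ _ ENNReal.ofReal_ne_top]
  refine lintegral_congr fun v => ?_
  have hΓ : 0 ≤ GammaKer d C (y - s • v) (s ^ 2) := by unfold GammaKer; positivity
  rw [← ENNReal.ofReal_mul (by positivity), ← ENNReal.ofReal_mul (by positivity),
    ← ENNReal.ofReal_mul (by positivity), ← ENNReal.ofReal_mul (by positivity),
    norm_mul_gammaKer_smul d b C hs]

theorem lintegral_setLIntegral_mul_le {X Y : Type*} [MeasurableSpace X] [MeasurableSpace Y]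
    (μ : Measure X) (ν : Measure Y) [SFinite μ] [SFinite ν] {G : Y × X → ℝ≥0∞}
    (hG : Measurable G) {k : X → ℝ≥0∞} (hk : Measurable k) {A : ℝ≥0∞} (B : Set Y)
    (hA : ∀ y, ∫⁻ z, G (y, z) * k z ∂μ ≤ A) :
    ∫⁻ z, (∫⁻ y in B, G (y, z) ∂ν) * k z ∂μ ≤ A * ν B := by
  calc ∫⁻ z, (∫⁻ y in B, G (y, z) ∂ν) * k z ∂μ
      = ∫⁻ z, ∫⁻ y in B, G (y, z) * k z ∂ν ∂μ := by
        refine lintegral_congr fun z => ?_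
        rw [lintegral_mul_const _ (by fun_prop)]
    _ = ∫⁻ y in B, ∫⁻ z, G (y, z) * k z ∂μ ∂ν := by
        refine lintegral_lintegral_swap (Measurable.aemeasurable ?_)
        fun_prop
    _ ≤ ∫⁻ _ in B, A ∂ν := lintegral_mono fun y => hA y
    _ = A * ν B := by simp

/-- the term `U₃`: there is `K` depending only on `d, β, C`
such that for all `ε ∈ (0,1]`, `0 < t₂ ≤ t₁ ≤ ε²` and `a₁, a₂ ∈ ℝ^d`,
`∫∫ (∫_{B(a₁,ε)} t₁^{−1}‖y−z₁‖ Γ_C(y−z₁,t₁) dy)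
   (∫_{B(a₂,ε)} t₂^{−1}‖y−z₂‖ Γ_C(y−z₂,t₂) dy) ‖z₁−z₂‖^{−β} dz₁ dz₂
  ≤ K ε^{2d} t₁^{−(1+β)/2} t₂^{−1/2}`. -/
theorem stmt_12 (d : ℕ) (hd : 1 ≤ d) (β C : ℝ) (hβ0 : 0 < β) (hβd : β < d)
    (hC : 0 < C) :
    ∃ K : ℝ, 0 < K ∧ ∀ ε ∈ Set.Ioc (0 : ℝ) 1, ∀ t₁ t₂ : ℝ,
      0 < t₂ → t₂ ≤ t₁ → t₁ ≤ ε ^ 2 → ∀ a₁ a₂ : EuclideanSpace ℝ (Fin d),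
        (∫ z₁ : EuclideanSpace ℝ (Fin d), ∫ z₂ : EuclideanSpace ℝ (Fin d),
            (∫ y in Metric.ball a₁ ε, t₁⁻¹ * ‖y - z₁‖ * GammaKer d C (y - z₁) t₁) *
            (∫ y in Metric.ball a₂ ε, t₂⁻¹ * ‖y - z₂‖ * GammaKer d C (y - z₂) t₂) *
              ‖z₁ - z₂‖ ^ (-β)) ≤
          K * ε ^ (2 * d) * t₁ ^ (-(1 + β) / 2) * t₂ ^ (-(1 : ℝ) / 2) := by
  obtain ⟨M₁, hM₁, h₁⟩ := exists_lintegral_norm_mul_exp_mul_rpow_le d hd hβ0.le hβd hC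
  obtain ⟨M₂, hM₂, h₂⟩ := exists_lintegral_norm_mul_exp_mul_rpow_le d (b := 0) hd le_rfl
    (by linarith) hC
  set V := (volume (Metric.ball (0 : EuclideanSpace ℝ (Fin d)) 1)).toReal with hV
  have hVt : volume (Metric.ball (0 : EuclideanSpace ℝ (Fin d)) 1) = ENNReal.ofReal V :=
    (ENNReal.ofReal_toReal measure_ball_lt_top.ne).symm
  have hVpos : 0 < V :=
    ENNReal.toReal_pos (Metric.measure_ball_pos _ _ one_pos).ne' measure_ball_lt_top.ne
  refine ⟨M₁ * M₂ * V ^ 2, by positivity, fun ε hε t₁ t₂ ht₂ h21 _ a₁ a₂ => ?_⟩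
  have ht₁ : 0 < t₁ := ht₂.trans_le h21
  have hε0 : 0 < ε := hε.1
  have hball : ∀ a : EuclideanSpace ℝ (Fin d),
      volume (Metric.ball a ε) = ENNReal.ofReal (ε ^ d * V) := by
    intro a
    rw [Measure.addHaar_ball_of_pos volume a hε0, hVt, finrank_euclideanSpace_fin,
      ENNReal.ofReal_mul (by positivity)]
  let G (t : ℝ) (p : EuclideanSpace ℝ (Fin d) × EuclideanSpace ℝ (Fin d)) : ℝ≥0∞ :=
    ENNReal.ofReal (t⁻¹ * ‖p.1 - p.2‖ * GammaKer d C (p.1 - p.2) t)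
  have hG : ∀ t, Measurable (G t) := measurable_norm_mul_gammaKer d C
  have hF : ∀ t, 0 < t → ∀ a z : EuclideanSpace ℝ (Fin d),
      ‖∫ y in Metric.ball a ε, t⁻¹ * ‖y - z‖ * GammaKer d C (y - z) t‖ₑ ≤
        ∫⁻ y in Metric.ball a ε, G t (y, z) := by
    intro t ht a z
    refine (enorm_integral_le_lintegral_enorm _).trans (lintegral_mono fun y => le_of_eq ?_)
    refine Real.enorm_of_nonneg ?_
    unfold GammaKer
    positivity
  have hP : ∀ t (a : EuclideanSpace ℝ (Fin d)),
      Measurable fun z => ∫⁻ y in Metric.ball a ε, G t (y, z) :=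
    fun t a => (hG t).lintegral_prod_left'
  set R := M₁ * M₂ * V ^ 2 * ε ^ (2 * d) * t₁ ^ (-(1 + β) / 2) * t₂ ^ (-(1 : ℝ) / 2) with hR
  have hR0 : 0 ≤ R := by positivity
  refine (Real.le_norm_self _).trans ?_
  rw [← ENNReal.ofReal_le_ofReal_iff hR0, ofReal_norm]
  have hA₁ : ∀ z₂ : EuclideanSpace ℝ (Fin d),
      ∫⁻ z₁, (∫⁻ y in Metric.ball a₁ ε, G t₁ (y, z₁)) * ENNReal.ofReal (‖z₁ - z₂‖ ^ (-β)) ≤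
        ENNReal.ofReal (t₁ ^ (-(1 + β) / 2) * M₁) * ENNReal.ofReal (ε ^ d * V) := by
    intro z₂
    rw [← hball a₁]
    exact lintegral_setLIntegral_mul_le volume volume (hG t₁) (by fun_prop) _
      fun y => lintegral_norm_mul_gammaKer_mul_rpow_le d h₁ ht₁ y z₂
  have hA₂ : ∫⁻ z₂, (∫⁻ y in Metric.ball a₂ ε, G t₂ (y, z₂)) ≤
        ENNReal.ofReal (t₂ ^ (-(1 : ℝ) / 2) * M₂) * ENNReal.ofReal (ε ^ d * V) := by
    rw [← hball a₂]
    have := lintegral_setLIntegral_mul_le volume volume (hG t₂) (k := fun _ => 1)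
      (A := ENNReal.ofReal (t₂ ^ (-(1 : ℝ) / 2) * M₂)) (by fun_prop) (Metric.ball a₂ ε)
      fun y => by simpa using lintegral_norm_mul_gammaKer_mul_rpow_le d h₂ ht₂ y 0
    simpa using this
  calc _ ≤ ∫⁻ z₁, ∫⁻ z₂, (∫⁻ y in Metric.ball a₁ ε, G t₁ (y, z₁)) *
        (∫⁻ y in Metric.ball a₂ ε, G t₂ (y, z₂)) * ENNReal.ofReal (‖z₁ - z₂‖ ^ (-β)) := by
        refine (enorm_integral_le_lintegral_enorm _).trans (lintegral_mono fun z₁ => ?_)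
        refine (enorm_integral_le_lintegral_enorm _).trans (lintegral_mono fun z₂ => ?_)
        rw [enorm_mul, enorm_mul,
          Real.enorm_of_nonneg (Real.rpow_nonneg (norm_nonneg (z₁ - z₂)) (-β))]
        gcongr
        · exact hF t₁ ht₁ a₁ z₁
        · exact hF t₂ ht₂ a₂ z₂
    _ = ∫⁻ z₂, ∫⁻ z₁, (∫⁻ y in Metric.ball a₁ ε, G t₁ (y, z₁)) *
        (∫⁻ y in Metric.ball a₂ ε, G t₂ (y, z₂)) * ENNReal.ofReal (‖z₁ - z₂‖ ^ (-β)) := by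
        refine lintegral_lintegral_swap (Measurable.aemeasurable ?_)
        exact (((hP t₁ a₁).comp measurable_fst).mul ((hP t₂ a₂).comp measurable_snd)).mul
          (by fun_prop)
    _ = ∫⁻ z₂, (∫⁻ y in Metric.ball a₂ ε, G t₂ (y, z₂)) *
        ∫⁻ z₁, (∫⁻ y in Metric.ball a₁ ε, G t₁ (y, z₁)) * ENNReal.ofReal (‖z₁ - z₂‖ ^ (-β)) := by
        refine lintegral_congr fun z₂ => ?_
        have hm : Measurable fun z₁ => (∫⁻ y in Metric.ball a₁ ε, G t₁ (y, z₁)) *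
            ENNReal.ofReal (‖z₁ - z₂‖ ^ (-β)) := (hP t₁ a₁).mul (by fun_prop)
        rw [← lintegral_const_mul _ hm]
        refine lintegral_congr fun z₁ => ?_
        ring
    _ ≤ ∫⁻ z₂, (∫⁻ y in Metric.ball a₂ ε, G t₂ (y, z₂)) *
        (ENNReal.ofReal (t₁ ^ (-(1 + β) / 2) * M₁) * ENNReal.ofReal (ε ^ d * V)) :=
        lintegral_mono fun z₂ => mul_le_mul_right (hA₁ z₂) _
    _ ≤ ENNReal.ofReal (t₂ ^ (-(1 : ℝ) / 2) * M₂) * ENNReal.ofReal (ε ^ d * V) *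
        (ENNReal.ofReal (t₁ ^ (-(1 + β) / 2) * M₁) * ENNReal.ofReal (ε ^ d * V)) := by
        rw [lintegral_mul_const _ (hP t₂ a₂)]
        exact mul_le_mul_left hA₂ _
    _ = ENNReal.ofReal R := by
        rw [← ENNReal.ofReal_mul (by positivity), ← ENNReal.ofReal_mul (by positivity),
          ← ENNReal.ofReal_mul (by positivity), hR]
        congr 1
        ring
end
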